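/- Let I = (n_1, …, n_l) be a composition of n and G_i ≤ GL_{n_i}(F_q). For each 1 ≤ i ≤ l, let P_i = F_q[x_{m_{i−1}+1}, …, x_{m_i}] with G_i acting on these n_i variables via GL_{n_i}(F_q), and suppose the set of all monomial factors of the monomial x_{m_{i−1}+1}^{α_{i,1}} ⋯ x_{m_i}^{α_{i,n_i}} is a basis of P_i as a module over P_i^{G_i}. Then P is a free P^{G_I}-module with basis { Π_{s=1}^n x_s^{a_s} · Π_{i=1}^l Π_{j=1}^{n_i} v_{i,j}^{b_{i,j}} : 0 ≤ a_s < q^{τ(s)} for all s, and 0 ≤ b_{i,j} ≤ α_{i,j} for all i, j }. -/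

import Mathlib

open MvPolynomial Finset

/-- The action of a matrix `g` on `F_q[x_1, …, x_n]`: the algebra map sending
`x_j` to `Σ_i g_{ij} x_i`. -/
noncomputable def matAct {K : Type*} [Field K] {n : ℕ} (g : Matrix (Fin n) (Fin n) K) :
    MvPolynomial (Fin n) K →ₐ[K] MvPolynomial (Fin n) K :=
  aeval fun j => ∑ i, C (g i j) * X i

/-- The subalgebra of polynomials invariant under every matrix in `G`. -/
noncomputable def invariants {K : Type*} [Field K] {n : ℕ} (G : Set (GL (Fin n) K)) :
    Subalgebra K (MvPolynomial (Fin n) K) where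
  carrier := {f | ∀ g ∈ G, matAct ((g : GL (Fin n) K) : Matrix (Fin n) (Fin n) K) f = f}
  mul_mem' := by
    intro a b ha hb g hg
    rw [map_mul, ha g hg, hb g hg]
  add_mem' := by
    intro a b ha hb g hg
    rw [map_add, ha g hg, hb g hg]
  algebraMap_mem' := by
    intro c g hg
    simp [matAct]

/-- The ideal generated by the homogeneous `G`-invariants of positive degree;
the quotient by it is the algebra of coinvariants. -/
noncomputable def coinvIdeal {K : Type*} [Field K] {n : ℕ} (G : Set (GL (Fin n) K)) :
    Ideal (MvPolynomial (Fin n) K) :=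
  Ideal.span {f | f ∈ invariants G ∧ ∃ d, 0 < d ∧ f.IsHomogeneous d}

/-- `tauf m s` is the largest partial sum `m i` which is `≤ s`; for `s` in the
`(j+1)`-st block this is `m j`. -/
def tauf {l : ℕ} (m : Fin (l + 1) → ℕ) (s : ℕ) : ℕ :=
  ((Finset.univ : Finset (Fin (l + 1))).filter fun i => m i ≤ s).sup m

/-- `U_I`: block upper triangular matrices whose diagonal blocks are identity
matrices (blocks determined by the partial sums `m`). -/
def USet (K : Type*) [Field K] {l : ℕ} (n : ℕ) (m : Fin (l + 1) → ℕ) :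
    Set (GL (Fin n) K) :=
  {g | ∀ s t : Fin n, tauf m (t : ℕ) ≤ tauf m (s : ℕ) →
    (g : Matrix (Fin n) (Fin n) K) s t = if s = t then 1 else 0}

/-- The global index of the `j`-th variable of the `i`-th block. -/
def emb {l : ℕ} (n : ℕ) (m : Fin (l + 1) → ℕ) (hmono : StrictMono m)
    (hlast : m (Fin.last l) = n) (i : Fin l)
    (j : Fin (m i.succ - m i.castSucc)) : Fin n :=
  ⟨m i.castSucc + (j : ℕ), by
    have h1 : m i.succ ≤ n := hlast ▸ hmono.monotone (Fin.le_last _)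
    have h2 := j.2
    omega⟩

/-- `G_I`: block upper triangular matrices whose `i`-th diagonal block lies in
`G i` (and whose entries above the diagonal blocks are arbitrary). -/
def GSet (K : Type*) [Field K] {l : ℕ} (n : ℕ) (m : Fin (l + 1) → ℕ)
    (hmono : StrictMono m) (hlast : m (Fin.last l) = n)
    (G : (i : Fin l) → Subgroup (GL (Fin (m i.succ - m i.castSucc)) K)) :
    Set (GL (Fin n) K) :=
  {g | (∀ s t : Fin n, tauf m (t : ℕ) < tauf m (s : ℕ) →
          (g : Matrix (Fin n) (Fin n) K) s t = 0) ∧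
    ∀ i : Fin l, ∃ h ∈ G i, ∀ j k : Fin (m i.succ - m i.castSucc),
      (g : Matrix (Fin n) (Fin n) K) (emb n m hmono hlast i j) (emb n m hmono hlast i k) =
        (h : Matrix (Fin (m i.succ - m i.castSucc)) (Fin (m i.succ - m i.castSucc)) K) j k}

/-- `Fpoly K k hk t = Π_{(λ_1,…,λ_k) ∈ K^k} (t + λ_1 x_1 + ⋯ + λ_k x_k)`. -/
noncomputable def Fpoly (K : Type*) [Field K] [Fintype K] {n : ℕ} (k : ℕ) (hk : k ≤ n)
    (t : MvPolynomial (Fin n) K) : MvPolynomial (Fin n) K :=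
  ∏ c : Fin k → K, (t + ∑ i : Fin k, C (c i) * X (Fin.castLE hk i))

/-- `v_{i,j} = F_{m_{i-1}}(x_{m_{i-1}+j})`. -/
noncomputable def vij (K : Type*) [Field K] [Fintype K] {l : ℕ} (n : ℕ)
    (m : Fin (l + 1) → ℕ) (hmono : StrictMono m) (hlast : m (Fin.last l) = n)
    (i : Fin l) (j : Fin (m i.succ - m i.castSucc)) : MvPolynomial (Fin n) K :=
  Fpoly K (m i.castSucc)
    (le_trans (hmono.monotone (Fin.le_last _)) (le_of_eq hlast))
    (X (emb n m hmono hlast i j))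

theorem prod_add_algebraMap_eq_pow_card_sub (K : Type*) [Field K] [Fintype K] {A : Type*}
    [CommRing A] [Algebra K A] (t : A) :
    ∏ c : K, (t + algebraMap K A c) = t ^ Fintype.card K - t := by
  have hq := Fintype.one_lt_card (α := K)
  have hmonic : (Polynomial.X ^ Fintype.card K - Polynomial.X : Polynomial K).Monic :=
    Polynomial.monic_X_pow_sub (by simpa using hq)
  have h := Polynomial.prod_multiset_X_sub_C_of_monic_of_roots_card_eq hmonic (by
    rw [FiniteField.roots_X_pow_card_sub_X, FiniteField.X_pow_card_sub_X_natDegree_eq K hq]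
    rfl)
  rw [FiniteField.roots_X_pow_card_sub_X] at h
  have h2 : ∏ c : K, (Polynomial.X - Polynomial.C c) =
      (Polynomial.X ^ Fintype.card K - Polynomial.X : Polynomial K) := h
  have h3 := congrArg (Polynomial.aeval t) h2
  simp only [map_prod, map_sub, Polynomial.aeval_X, Polynomial.aeval_C, map_pow] at h3
  rw [← h3, ← Equiv.prod_comp (Equiv.neg K)]
  simp [sub_eq_add_neg]

theorem prod_add_smul_eq (K : Type*) [Field K] [Fintype K] {R : Type*} [CommRing R] [IsDomain R]
    [Algebra K R] (t y : R) :
    ∏ c : K, (t + c • y) = t ^ Fintype.card K - y ^ (Fintype.card K - 1) * t := by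
  have hq := Fintype.one_lt_card (α := K)
  obtain ⟨k, hk⟩ : ∃ k, Fintype.card K = k + 1 + 1 := ⟨Fintype.card K - 2, by omega⟩
  by_cases hy : y = 0
  · simp [hy, hk]
  apply IsFractionRing.injective R (FractionRing R)
  have hy' : algebraMap R (FractionRing R) y ≠ 0 := by simpa using hy
  have h := prod_add_algebraMap_eq_pow_card_sub K (A := FractionRing R)
    (algebraMap R (FractionRing R) t / algebraMap R (FractionRing R) y)
  have h1 : ∀ c : K, algebraMap R (FractionRing R) (t + c • y) =
      algebraMap R (FractionRing R) y * (algebraMap R (FractionRing R) t /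
        algebraMap R (FractionRing R) y + algebraMap K (FractionRing R) c) := by
    intro c
    rw [mul_add, mul_div_cancel₀ _ hy', map_add, Algebra.smul_def, map_mul,
      ← IsScalarTower.algebraMap_apply, mul_comm (algebraMap K _ c)]
  rw [map_prod]
  simp_rw [h1]
  rw [prod_mul_distrib, h, prod_const, card_univ, hk]
  simp only [map_sub, map_mul, map_pow, Nat.add_sub_cancel, div_pow]
  field_simp
  ring

/-- The product of the translates of `t` by all linear combinations of the `y i` is `K`-linear
in `t`. -/
theorem exists_linearMap_eq_prod_add_sum (K : Type*) [Field K] [Fintype K] {R : Type*} [CommRing R]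
    [IsDomain R] [Algebra K R] {k : ℕ} (y : Fin k → R) :
    ∃ L : R →ₗ[K] R, ∀ t, L t = ∏ c : Fin k → K, (t + ∑ i, c i • y i) := by
  induction k with
  | zero => exact ⟨LinearMap.id, fun t => by simp⟩
  | succ k ih =>
    obtain ⟨L, hL⟩ := ih fun i => y i.succ
    refine ⟨(FiniteField.frobeniusAlgHom K R).toLinearMap ∘ₗ L -
      LinearMap.mulLeft K (L (y 0) ^ (Fintype.card K - 1)) ∘ₗ L, fun t => ?_⟩
    rw [← (Fin.consEquiv fun _ => K).prod_comp, Fintype.prod_prod_type]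
    simp only [Fin.consEquiv_apply, Fin.sum_univ_succ, Fin.cons_zero, Fin.cons_succ, ← add_assoc,
      ← hL, map_add, map_smul]
    rw [prod_add_smul_eq]
    simp

/-- A spanning family over a subalgebra that is fixed by as many distinct endomorphisms as the
family has members is linearly independent. -/
theorem linearIndependent_of_span_eq_top_of_fixed {K R κ : Type*} [CommRing K] [CommRing R]
    [IsDomain R] [Algebra K R] [Finite κ] (B : Subalgebra K R) (σ : κ → R →ₐ[K] R)
    (hσ : Function.Injective σ) (hB : ∀ k, ∀ x ∈ B, σ k x = x) (e : κ → R)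
    (he : Submodule.span B (Set.range e) = ⊤) : LinearIndependent B e := by
  classical
  cases nonempty_fintype κ
  have hdet : (Matrix.of fun k j => σ k (e j)).det ≠ 0 := by
    intro h0
    obtain ⟨v, hv, hv0⟩ := Matrix.exists_vecMul_eq_zero_iff.2 h0
    have hall : ∀ x, ∑ k, v k * σ k x = 0 := by
      intro x
      have hx : x ∈ Submodule.span B (Set.range e) := he ▸ Submodule.mem_top
      induction hx using Submodule.span_induction with
      | mem x hx => obtain ⟨j, rfl⟩ := hx; exact congrFun hv0 j
      | zero => simp
      | add x y _ _ hx hy => simp [mul_add, sum_add_distrib, hx, hy]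
      | smul b x _ hx =>
        have h1 : ∀ k, v k * σ k (b • x) = (b : R) * (v k * σ k x) := fun k => by
          rw [Subalgebra.smul_def, smul_eq_mul, map_mul, hB k b b.2]; ring
        simp_rw [h1, ← mul_sum, hx, mul_zero]
    have hind := (linearIndependent_monoidHom R R).comp (fun k => (σ k : R →* R))
      fun a b h => hσ (AlgHom.ext fun x => DFunLike.congr_fun h x)
    refine hv (funext fun k => Fintype.linearIndependent_iff.1 hind v ?_ k)
    ext x
    simpa using hall x
  rw [Fintype.linearIndependent_iff]
  intro c hc j
  by_contra hj
  refine hdet (Matrix.exists_mulVec_eq_zero_iff.1 ⟨fun j => (c j : R), ?_, ?_⟩)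
  · exact fun h => hj (Subtype.ext (congrFun h j))
  · ext k
    have h := congrArg (σ k) hc
    simp only [map_sum, Subalgebra.smul_def, smul_eq_mul, map_mul, map_zero, hB k _ (c _).2] at h
    simpa [Matrix.mulVec, dotProduct, mul_comm] using h

/-- A family that is linearly independent over the fixed elements of a finite group has at most as
many members as the group. -/
theorem card_le_of_linearIndependent_fixed {K R κ H : Type*} [CommRing K] [CommRing R]
    [IsDomain R] [Algebra K R] [Group H] [Finite H] [Fintype κ] (B : Subalgebra K R)
    (σ : H →* (R →ₐ[K] R)) (hσ : Function.Injective σ) (hB : ∀ x, (∀ h, σ h x = x) → x ∈ B)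
    (e : κ → R) (he : LinearIndependent B e) : Fintype.card κ ≤ Nat.card H := by
  classical
  cases nonempty_fintype H
  have hcol : LinearIndependent R fun (k : κ) (h : H) => σ h (e k) := by
    rw [Fintype.linearIndependent_iff]
    intro d hd k
    have hd' : ∀ h, ∑ k, d k * σ h (e k) = 0 := fun h => by simpa using congrFun hd h
    have htr : ∀ y k, ∑ h, σ h (y * d k) = 0 := by
      intro y
      have hmem : ∀ k, ∑ h, σ h (y * d k) ∈ B := by
        refine fun k => hB _ fun g => ?_
        rw [map_sum, ← Equiv.sum_comp (Equiv.mulLeft g) fun h => σ h (y * d k)]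
        simp [AlgHom.mul_apply]
      have hz : ∑ k, (⟨_, hmem k⟩ : B) • e k = 0 := by
        simp only [Subalgebra.smul_def, smul_eq_mul, sum_mul]
        rw [sum_comm]
        refine sum_eq_zero fun h _ => ?_
        have h1 : ∀ k, σ h (y * d k) * e k = σ h (y * (d k * σ h⁻¹ (e k))) := fun k => by
          rw [← mul_assoc, map_mul _ (y * d k), ← AlgHom.mul_apply, ← map_mul σ]
          simp
        simp_rw [h1]
        rw [← map_sum, ← mul_sum, hd', mul_zero, map_zero]
      exact fun k => congrArg Subtype.val (Fintype.linearIndependent_iff.1 he _ hz k)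
    have hind := (linearIndependent_monoidHom R R).comp (fun h => (σ h : R →* R))
      fun a b h => hσ (AlgHom.ext fun x => DFunLike.congr_fun h x)
    have h1 := Fintype.linearIndependent_iff.1 hind (fun h => σ h (d k)) (by
      ext y
      simpa [mul_comm] using htr y k) 1
    simpa using h1
  simpa using hcol.fintype_card_le_finrank

/-- The lexicographic monomial order in which variables with larger index are larger. -/
noncomputable def revLex (n : ℕ) : MonomialOrder (Fin n) :=
  MonomialOrder.lex (σ := (Fin n)ᵒᵈ)

theorem revLex_single_lt {n : ℕ} {i s : Fin n} (h : i < s) :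
    (revLex n).toSyn (Finsupp.single i 1) < (revLex n).toSyn (Finsupp.single s 1) :=
  (Finsupp.Lex.lt_iff (α := (Fin n)ᵒᵈ) (N := ℕ)).2
    ⟨OrderDual.toDual s, fun j (hj : s < OrderDual.ofDual j) => by
      have h1 : OrderDual.ofDual j ≠ i := (h.trans hj).ne'
      have h2 : OrderDual.ofDual j ≠ s := hj.ne'
      change (Finsupp.single i 1 : Fin n →₀ ℕ) (OrderDual.ofDual j) =
        (Finsupp.single s 1 : Fin n →₀ ℕ) (OrderDual.ofDual j)
      rw [Finsupp.single_eq_of_ne h1, Finsupp.single_eq_of_ne h2], by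
      change (Finsupp.single i 1 : Fin n →₀ ℕ) s < (Finsupp.single s 1 : Fin n →₀ ℕ) s
      simp [h.ne']⟩

/-- Polynomials `v s` that are monic with leading monomial `X s ^ q s` yield, together with the
monomials having exponents below `q`, a spanning set of the polynomial ring. -/
theorem span_prod_X_pow_mul_prod_pow_eq_top {K σ : Type*} [Field K] [Fintype σ]
    (o : MonomialOrder σ) (q : σ → ℕ) (hq : ∀ s, 0 < q s) (v : σ → MvPolynomial σ K)
    (hv : ∀ s, o.Monic (v s)) (hdeg : ∀ s, o.degree (v s) = Finsupp.single s (q s)) :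
    Submodule.span K {f | ∃ a b : σ → ℕ, (∀ s, a s < q s) ∧
      f = (∏ s, X s ^ a s) * ∏ s, v s ^ b s} = (⊤ : Submodule K (MvPolynomial σ K)) := by
  classical
  rw [eq_top_iff]
  rintro f -
  set S := Submodule.span K {f : MvPolynomial σ K | ∃ a b : σ → ℕ, (∀ s, a s < q s) ∧
      f = (∏ s, X s ^ a s) * ∏ s, v s ^ b s}
  have key : ∀ d : o.syn, ∀ f : MvPolynomial σ K, o.toSyn (o.degree f) = d → f ∈ S := by
    intro d
    induction d using WellFoundedLT.induction with
    | ind d ih =>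
    intro f hf
    set D := o.degree f with hD
    set e : MvPolynomial σ K := (∏ s, X s ^ (D s % q s)) * ∏ s, v s ^ (D s / q s) with he
    have heS : e ∈ S := Submodule.subset_span ⟨_, _, fun s => Nat.mod_lt _ (hq s), he⟩
    have hm1 : o.Monic (∏ s, X s ^ (D s % q s) : MvPolynomial σ K) :=
      MonomialOrder.Monic.prod fun s _ => MonomialOrder.monic_X.pow
    have hm2 : o.Monic (∏ s, v s ^ (D s / q s)) :=
      MonomialOrder.Monic.prod fun s _ => (hv s).pow
    have hem : o.Monic e := hm1.mul hm2
    have hed : o.degree e = D := by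
      rw [he, MonomialOrder.degree_mul hm1.ne_zero hm2.ne_zero,
        MonomialOrder.degree_prod fun s _ => ((MonomialOrder.monic_X (m := o)).pow).ne_zero,
        MonomialOrder.degree_prod fun s _ => ((hv s).pow).ne_zero]
      simp only [MonomialOrder.degree_pow, MonomialOrder.degree_X, hdeg]
      ext t
      simp [Finsupp.single_apply, mul_ite, mul_comm, Nat.mod_add_div]
    by_cases hD0 : D = 0
    · have : f = C (o.leadingCoeff f) := MonomialOrder.eq_C_of_degree_eq_zero hD0
      have he1 : e = 1 := by simp [he, hD0]
      rw [this, ← mul_one (C _), ← he1, ← smul_eq_C_mul]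
      exact S.smul_mem _ heS
    · have hle : o.toSyn (o.degree (f - o.leadingCoeff f • e)) ≤ o.toSyn D := by
        refine (MonomialOrder.degree_sub_le).trans (sup_le le_rfl ?_)
        exact (MonomialOrder.degree_smul_le).trans (hed ▸ le_rfl)
      have hlt : o.toSyn (o.degree (f - o.leadingCoeff f • e)) < d := by
        rw [← hf]
        refine lt_of_le_of_ne hle fun h => ?_
        have h' := o.toSyn.injective h
        have hc : o.leadingCoeff (f - o.leadingCoeff f • e) = 0 := by
          rw [MonomialOrder.leadingCoeff, h', coeff_sub, coeff_smul, ← hed, hem.coeff_degree, hed]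
          simp [MonomialOrder.leadingCoeff, hD]
        rw [MonomialOrder.leadingCoeff_eq_zero_iff] at hc
        rw [hc, MonomialOrder.degree_zero] at h'
        exact hD0 h'.symm
      have := S.add_mem (ih _ hlt _ rfl) (S.smul_mem (o.leadingCoeff f) heS)
      simpa using this
  exact key _ f rfl

/-- A product over all translates of `X s` by combinations of the first `k ≤ s` variables has
leading monomial `X s ^ (q ^ k)`. -/
theorem monic_and_degree_prod_X_add_sum {K : Type*} [Field K] [Fintype K] {n k : ℕ} (hk : k ≤ n)
    (s : Fin n) (hs : k ≤ s) :
    (revLex n).Monic (∏ c : Fin k → K, (X s + ∑ i : Fin k, C (c i) * X (Fin.castLE hk i))) ∧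
    (revLex n).degree (∏ c : Fin k → K, (X s + ∑ i : Fin k, C (c i) * X (Fin.castLE hk i))) =
      Finsupp.single s (Fintype.card K ^ k) := by
  classical
  have hlt : ∀ c : Fin k → K, (revLex n).toSyn ((revLex n).degree
      (∑ i : Fin k, C (c i) * X (Fin.castLE hk i) : MvPolynomial (Fin n) K)) <
      (revLex n).toSyn ((revLex n).degree (X s : MvPolynomial (Fin n) K)) := by
    intro c
    rw [MonomialOrder.degree_X]
    have hpos : 0 < (revLex n).toSyn (Finsupp.single s 1) := by
      rw [MonomialOrder.toSyn_lt_iff_ne_zero]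
      simp
    refine lt_of_le_of_lt MonomialOrder.degree_sum_le ?_
    rw [Finset.sup_lt_iff (by simpa using hpos)]
    intro i _
    rw [← smul_eq_C_mul]
    refine lt_of_le_of_lt (MonomialOrder.degree_smul_le.trans MonomialOrder.degree_X_le_single) ?_
    exact revLex_single_lt (Fin.lt_def.2 (lt_of_lt_of_le i.2 hs))
  have hmon : ∀ c : Fin k → K, (revLex n).Monic
      (X s + ∑ i : Fin k, C (c i) * X (Fin.castLE hk i)) := fun c =>
    MonomialOrder.monic_X.add_of_lt (hlt c)
  refine ⟨MonomialOrder.Monic.prod fun c _ => hmon c, ?_⟩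
  rw [MonomialOrder.degree_prod fun c _ => (hmon c).ne_zero]
  simp_rw [MonomialOrder.degree_add_of_lt (hlt _), MonomialOrder.degree_X]
  simp

section matAct

variable {K : Type*} [Field K] {n : ℕ}

theorem matAct_X (g : Matrix (Fin n) (Fin n) K) (j : Fin n) :
    matAct g (X j) = ∑ i, C (g i j) * X i := by
  simp [matAct]

theorem matAct_mul (g h : Matrix (Fin n) (Fin n) K) :
    matAct (g * h) = (matAct g).comp (matAct h) := by
  refine MvPolynomial.algHom_ext fun j => ?_
  rw [AlgHom.comp_apply, matAct_X, matAct_X, map_sum]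
  simp only [map_mul, matAct_X, algHom_C, Matrix.mul_apply, map_sum, sum_mul, mul_sum]
  rw [sum_comm]
  refine sum_congr rfl fun i _ => sum_congr rfl fun k _ => ?_
  rw [algebraMap_eq]
  ring

theorem matAct_one : matAct (1 : Matrix (Fin n) (Fin n) K) = AlgHom.id K _ := by
  refine MvPolynomial.algHom_ext fun j => ?_
  simp [matAct_X, Matrix.one_apply, apply_ite, ite_mul]

theorem matAct_injective :
    Function.Injective (matAct : Matrix (Fin n) (Fin n) K → _) := by
  classical
  intro g h hgh
  ext i j
  have h1 := congrArg (coeff (Finsupp.single i 1)) (DFunLike.congr_fun hgh (X j))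
  simpa [matAct_X, coeff_sum, coeff_C_mul, MvPolynomial.coeff_X, Finsupp.single_left_inj] using h1

variable (K n) in
/-- The action of `GL_n` on polynomials as a homomorphism into the algebra endomorphisms. -/
noncomputable def matActHom :
    GL (Fin n) K →* (MvPolynomial (Fin n) K →ₐ[K] MvPolynomial (Fin n) K) where
  toFun g := matAct (g : Matrix (Fin n) (Fin n) K)
  map_one' := matAct_one
  map_mul' _ _ := matAct_mul _ _

theorem matActHom_injective : Function.Injective (matActHom K n) :=
  fun _ _ h => Units.ext (matAct_injective h)

theorem matAct_coe_injective (g : GL (Fin n) K) :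
    Function.Injective (matAct (g : Matrix (Fin n) (Fin n) K)) := by
  refine Function.LeftInverse.injective (g := matActHom K n g⁻¹) fun x => ?_
  change (matActHom K n g⁻¹ * matActHom K n g) x = x
  rw [← map_mul]
  simp

end matAct

section Fpoly

variable {K : Type*} [Field K] [Fintype K] {n k : ℕ} (hk : k ≤ n)

theorem exists_linearMap_eq_Fpoly : ∃ L : MvPolynomial (Fin n) K →ₗ[K] MvPolynomial (Fin n) K,
    ∀ t, L t = Fpoly K k hk t := by
  obtain ⟨L, hL⟩ := exists_linearMap_eq_prod_add_sum K
    fun i : Fin k => (X (Fin.castLE hk i) : MvPolynomial (Fin n) K)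
  exact ⟨L, fun t => by simp only [hL, Fpoly, smul_eq_C_mul]⟩

theorem Fpoly_X_of_lt (s : Fin n) (hs : (s : ℕ) < k) : Fpoly K k hk (X s) = 0 := by
  classical
  refine prod_eq_zero (mem_univ (Pi.single ⟨s, hs⟩ (-1))) ?_
  rw [sum_eq_single ⟨s, hs⟩ (fun i _ hi => by simp [Pi.single_eq_of_ne hi]) (by simp)]
  simp

omit [Fintype K] in
theorem linearForm_injective : Function.Injective fun c : Fin k → K =>
    (∑ i : Fin k, C (c i) * X (Fin.castLE hk i) : MvPolynomial (Fin n) K) := by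
  classical
  intro c d h
  ext i
  have h1 := congrArg (coeff (Finsupp.single (Fin.castLE hk i) 1)) h
  simpa [coeff_sum, coeff_C_mul, MvPolynomial.coeff_X, Finsupp.single_left_inj] using h1

theorem matAct_Fpoly (g : GL (Fin n) K)
    (hg : ∀ s t : Fin n, (t : ℕ) < k → k ≤ (s : ℕ) → (g : Matrix (Fin n) (Fin n) K) s t = 0)
    (t : MvPolynomial (Fin n) K) :
    matAct (g : Matrix (Fin n) (Fin n) K) (Fpoly K k hk t) =
      Fpoly K k hk (matAct (g : Matrix (Fin n) (Fin n) K) t) := by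
  set M := (g : Matrix (Fin n) (Fin n) K) with hM
  let A : (Fin k → K) → (Fin k → K) := fun c i => ∑ j, M (Fin.castLE hk i) (Fin.castLE hk j) * c j
  have hX : ∀ j : Fin k, matAct M (X (Fin.castLE hk j)) =
      ∑ i : Fin k, C (M (Fin.castLE hk i) (Fin.castLE hk j)) * X (Fin.castLE hk i) := by
    intro j
    rw [matAct_X]
    symm
    refine sum_of_injOn (Fin.castLE hk) (Fin.castLE_injective hk).injOn (by simp) ?_
      fun _ _ => rfl
    intro s _ hs
    rw [hg s _ (by simp) (not_lt.1 fun h => hs ⟨⟨s, h⟩, by simp⟩), C_0, zero_mul]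
  have hA : ∀ c : Fin k → K, matAct M (∑ i : Fin k, C (c i) * X (Fin.castLE hk i)) =
      ∑ i : Fin k, C (A c i) * X (Fin.castLE hk i) := by
    intro c
    simp only [map_sum, map_mul, hX, algHom_C, algebraMap_eq, A, mul_sum, sum_mul]
    rw [sum_comm]
    exact sum_congr rfl fun i _ => sum_congr rfl fun j _ => by ring
  have hinj : Function.Injective A := by
    intro c d h
    refine linearForm_injective hk (matAct_coe_injective g ?_)
    simp only [← hM, hA, h]
  rw [Fpoly, Fpoly, map_prod]
  refine Fintype.prod_bijective A (Finite.injective_iff_bijective.1 hinj) _ _ fun c => ?_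
  rw [map_add, hA]

end Fpoly

section blocks

variable {l n : ℕ} {m : Fin (l + 1) → ℕ} (hmono : StrictMono m) (hlast : m (Fin.last l) = n)

theorem tauf_emb (i : Fin l) (j : Fin (m i.succ - m i.castSucc)) :
    tauf m (emb n m hmono hlast i j) = m i.castSucc := by
  have hj := j.2
  refine le_antisymm (Finset.sup_le fun k hk => ?_)
    (Finset.le_sup (f := m) (Finset.mem_filter.2 ⟨mem_univ _, Nat.le_add_right _ _⟩))
  have h1 : m k < m i.succ := lt_of_le_of_lt (by simpa using hk) (by simp only [emb]; omega)
  exact hmono.monotone (Fin.le_castSucc_iff.2 (hmono.lt_iff_lt.1 h1))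

theorem emb_lt (i : Fin l) (j : Fin (m i.succ - m i.castSucc)) :
    (emb n m hmono hlast i j : ℕ) < m i.succ := by
  have hj := j.2
  simp only [emb]
  omega

theorem emb_bijective (hm0 : m 0 = 0) : Function.Bijective
    fun x : Σ i : Fin l, Fin (m i.succ - m i.castSucc) => emb n m hmono hlast x.1 x.2 := by
  constructor
  · rintro ⟨i, j⟩ ⟨i', j'⟩ h
    have h' : emb n m hmono hlast i j = emb n m hmono hlast i' j' := h
    have hi : i = i' := by
      apply Fin.castSucc_injective
      apply hmono.injective
      rw [← tauf_emb hmono hlast i j, h', tauf_emb]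
    subst hi
    have := congrArg Fin.val h'
    simp only [emb, Nat.add_left_cancel_iff] at this
    rw [Fin.ext this]
  · intro s
    have key : ∀ k : Fin (l + 1), (s : ℕ) < m k →
        ∃ i : Fin l, m i.castSucc ≤ s ∧ (s : ℕ) < m i.succ := by
      intro k
      induction k using Fin.induction with
      | zero => intro h; omega
      | succ i ih =>
        intro h
        by_cases hs : (s : ℕ) < m i.castSucc
        · exact ih hs
        · exact ⟨i, not_lt.1 hs, h⟩
    obtain ⟨i, h1, h2⟩ := key (Fin.last l) (hlast ▸ s.2)
    refine ⟨⟨i, ⟨s - m i.castSucc, by omega⟩⟩, Fin.ext ?_⟩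
    simp only [emb]
    omega

/-- The variables of the blocks, indexed by block and position, enumerate all variables. -/
noncomputable def blockEquiv (hm0 : m 0 = 0) :
    (Σ i : Fin l, Fin (m i.succ - m i.castSucc)) ≃ Fin n :=
  Equiv.ofBijective _ (emb_bijective hmono hlast hm0)

theorem blockEquiv_apply (hm0 : m 0 = 0) (x : Σ i : Fin l, Fin (m i.succ - m i.castSucc)) :
    blockEquiv hmono hlast hm0 x = emb n m hmono hlast x.1 x.2 := rfl

variable {K : Type*} [Field K] [Fintype K]
  {G : (i : Fin l) → Subgroup (GL (Fin (m i.succ - m i.castSucc)) K)}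

theorem matAct_vij (hm0 : m 0 = 0) {g : GL (Fin n) K} (hg : g ∈ GSet K n m hmono hlast G)
    (i : Fin l) (h : Matrix (Fin (m i.succ - m i.castSucc)) (Fin (m i.succ - m i.castSucc)) K)
    (hh : ∀ j k, (g : Matrix (Fin n) (Fin n) K) (emb n m hmono hlast i j)
      (emb n m hmono hlast i k) = h j k) (j : Fin (m i.succ - m i.castSucc)) :
    matAct (g : Matrix (Fin n) (Fin n) K) (vij K n m hmono hlast i j) =
      ∑ k, C (h k j) * vij K n m hmono hlast i k := by
  have hsurj := (emb_bijective hmono hlast hm0).2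
  have hle : m i.castSucc ≤ n := (hmono.monotone (Fin.le_last _)).trans hlast.le
  obtain ⟨L, hL⟩ := exists_linearMap_eq_Fpoly (K := K) hle
  unfold vij
  rw [matAct_Fpoly, ← hL, matAct_X, map_sum,
    ← (blockEquiv hmono hlast hm0).sum_comp, Fintype.sum_sigma, sum_eq_single i]
  · refine sum_congr rfl fun k _ => ?_
    rw [blockEquiv_apply, ← smul_eq_C_mul, map_smul, hh, smul_eq_C_mul, hL]
  · intro i' _ hi'
    refine sum_eq_zero fun k _ => ?_
    rw [blockEquiv_apply, ← smul_eq_C_mul, map_smul]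
    rcases lt_or_gt_of_ne hi' with h1 | h1
    · rw [hL, Fpoly_X_of_lt, smul_zero]
      exact (emb_lt hmono hlast i' k).trans_le (hmono.monotone (Fin.succ_le_castSucc_iff.2 h1))
    · rw [hg.1, zero_smul]
      rw [tauf_emb, tauf_emb]
      exact hmono (Fin.castSucc_lt_castSucc_iff.2 h1)
  · simp
  · intro s t ht hs
    apply hg.1
    obtain ⟨⟨is, js⟩, rfl⟩ := hsurj s
    obtain ⟨⟨it, jt⟩, rfl⟩ := hsurj t
    simp only [tauf_emb] at *
    refine lt_of_lt_of_le (b := m i.castSucc) ?_ ?_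
    · refine lt_of_le_of_lt ?_ ht
      simp [emb]
    · have h1 := hs.trans_lt (emb_lt hmono hlast is js)
      exact hmono.monotone (Fin.castSucc_le_castSucc_iff.2
        (Fin.castSucc_lt_succ_iff.1 (hmono.lt_iff_lt.1 h1)))

theorem tauf_le (s : ℕ) : tauf m s ≤ s :=
  Finset.sup_le fun _ hk => (Finset.mem_filter.1 hk).2

omit [Fintype K] in
/-- `GSet` contains matrices with arbitrary diagonal blocks from the `G i` and arbitrary entries
above the diagonal blocks. -/
theorem exists_mem_GSet (hm0 : m 0 = 0)
    (h : (i : Fin l) → GL (Fin (m i.succ - m i.castSucc)) K) (hG : ∀ i, h i ∈ G i)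
    (c : Fin n → Fin n → K) :
    ∃ g ∈ GSet K n m hmono hlast G,
      (∀ i j k, (g : Matrix (Fin n) (Fin n) K) (emb n m hmono hlast i j)
        (emb n m hmono hlast i k) = (h i : Matrix _ _ K) j k) ∧
      ∀ s t : Fin n, (s : ℕ) < tauf m t → (g : Matrix (Fin n) (Fin n) K) s t = c s t := by
  classical
  set e := blockEquiv hmono hlast hm0
  let D := Matrix.blockDiagonal' fun i => (h i).val
  let N : Matrix (Σ i : Fin l, Fin (m i.succ - m i.castSucc))
      (Σ i : Fin l, Fin (m i.succ - m i.castSucc)) K :=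
    fun x y => D x y + if x.1 < y.1 then c (e x) (e y) else 0
  have hNdiag : ∀ i j k, N ⟨i, j⟩ ⟨i, k⟩ = (h i : Matrix _ _ K) j k := by
    intro i j k
    simp [N, D, Matrix.blockDiagonal'_apply_eq]
  have hNlow : ∀ x y : Σ i : Fin l, Fin (m i.succ - m i.castSucc), y.1 < x.1 → N x y = 0 := by
    rintro ⟨i, j⟩ ⟨i', j'⟩ hlt
    simp only at hlt
    simp [N, D, Matrix.blockDiagonal'_apply_ne _ _ _ hlt.ne', hlt.not_gt]
  have hNup : ∀ x y : Σ i : Fin l, Fin (m i.succ - m i.castSucc), x.1 < y.1 →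
      N x y = c (e x) (e y) := by
    rintro ⟨i, j⟩ ⟨i', j'⟩ hlt
    simp only at hlt
    simp [N, D, Matrix.blockDiagonal'_apply_ne _ _ _ hlt.ne, hlt]
  have hdet : IsUnit N.det := by
    have hT : N.BlockTriangular Sigma.fst := fun x y hxy => hNlow x y hxy
    rw [hT.det_fintype]
    refine isUnit_iff_ne_zero.2 (prod_ne_zero_iff.2 fun i _ => ?_)
    rw [← Matrix.det_submatrix_equiv_self (Equiv.sigmaSubtype i).symm]
    have : (N.toSquareBlock Sigma.fst i).submatrix (Equiv.sigmaSubtype i).symm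
        (Equiv.sigmaSubtype i).symm = (h i : Matrix _ _ K) := by
      ext j k
      exact hNdiag i j k
    rw [this]
    exact ((Matrix.isUnit_iff_isUnit_det _).1 (h i).isUnit).ne_zero
  have hM : IsUnit (Matrix.reindex e e N).det := by rwa [Matrix.det_reindex_self]
  let g : GL (Fin n) K := Matrix.GeneralLinearGroup.mk'' _ hM
  have hg : ∀ x y, (g : Matrix (Fin n) (Fin n) K) (e x) (e y) = N x y := by
    intro x y
    change Matrix.reindex e e N (e x) (e y) = N x y
    simp
  have htau : ∀ x, tauf m (e x : ℕ) = m x.1.castSucc := fun x => tauf_emb hmono hlast x.1 x.2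
  have hblock : ∀ i j k, (g : Matrix (Fin n) (Fin n) K) (emb n m hmono hlast i j)
      (emb n m hmono hlast i k) = (h i : Matrix _ _ K) j k := fun i j k =>
    (hg ⟨i, j⟩ ⟨i, k⟩).trans (hNdiag i j k)
  refine ⟨g, ⟨fun s t hst => ?_, fun i => ⟨h i, hG i, hblock i⟩⟩, hblock, fun s t hst => ?_⟩
  · obtain ⟨x, rfl⟩ := e.surjective s
    obtain ⟨y, rfl⟩ := e.surjective t
    rw [htau, htau] at hst
    rw [hg]
    exact hNlow x y (Fin.castSucc_lt_castSucc_iff.1 (hmono.lt_iff_lt.1 hst))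
  · obtain ⟨x, rfl⟩ := e.surjective s
    obtain ⟨y, rfl⟩ := e.surjective t
    rw [htau] at hst
    rw [hg]
    refine hNup x y (Fin.castSucc_lt_castSucc_iff.1 (hmono.lt_iff_lt.1 (lt_of_le_of_lt ?_ hst)))
    rw [← htau]
    exact tauf_le _

/-- The substitution of the `v_{i,j}` for the variables of block `i` maps invariants of `G i` to
invariants of the block triangular group. -/
theorem aeval_vij_mem_invariants (hm0 : m 0 = 0) (i : Fin l)
    {f : MvPolynomial (Fin (m i.succ - m i.castSucc)) K}
    (hf : f ∈ invariants (G i : Set (GL (Fin (m i.succ - m i.castSucc)) K))) :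
    aeval (vij K n m hmono hlast i) f ∈ invariants (GSet K n m hmono hlast G) := by
  intro g hg
  obtain ⟨h, hhG, hh⟩ := hg.2 i
  have hcomp : (matAct (g : Matrix (Fin n) (Fin n) K)).comp (aeval (vij K n m hmono hlast i)) =
      (aeval (vij K n m hmono hlast i)).comp
        (matAct (h : Matrix (Fin (m i.succ - m i.castSucc)) _ K)) := by
    refine MvPolynomial.algHom_ext fun j => ?_
    rw [AlgHom.comp_apply, AlgHom.comp_apply, aeval_X,
      matAct_vij hmono hlast hm0 hg i _ hh, matAct_X]
    simp [algHom_C, algebraMap_eq]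
  have h1 := DFunLike.congr_fun hcomp f
  rw [AlgHom.comp_apply, AlgHom.comp_apply, hf h hhG] at h1
  exact h1

theorem aeval_vij_mem_span (hm0 : m 0 = 0) (i : Fin l) {ι : Type*}
    (e : ι → MvPolynomial (Fin (m i.succ - m i.castSucc)) K)
    (he : Submodule.span (invariants (G i : Set (GL (Fin (m i.succ - m i.castSucc)) K)))
      (Set.range e) = ⊤) (f : MvPolynomial (Fin (m i.succ - m i.castSucc)) K) :
    aeval (vij K n m hmono hlast i) f ∈ Submodule.span (invariants (GSet K n m hmono hlast G))
      (Set.range fun c => aeval (vij K n m hmono hlast i) (e c)) := by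
  have hf := he ▸ (Submodule.mem_top : f ∈ ⊤)
  induction hf using Submodule.span_induction with
  | mem x hx => obtain ⟨c, rfl⟩ := hx; exact Submodule.subset_span ⟨c, rfl⟩
  | zero => rw [map_zero]; exact Submodule.zero_mem _
  | add x y _ _ hx hy => rw [map_add]; exact Submodule.add_mem _ hx hy
  | smul b x _ hx =>
    rw [Subalgebra.smul_def, smul_eq_mul, map_mul]
    exact Submodule.smul_mem _
      (⟨_, aeval_vij_mem_invariants hmono hlast hm0 i b.2⟩ :
        invariants (GSet K n m hmono hlast G)) hx

end blocks

theorem Submodule.prod_mem_prod {ι R A : Type*} [CommSemiring R] [CommSemiring A] [Algebra R A]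
    (s : Finset ι) (M : ι → Submodule R A) (f : ι → A) (h : ∀ i ∈ s, f i ∈ M i) :
    ∏ i ∈ s, f i ∈ ∏ i ∈ s, M i := by
  classical
  induction s using Finset.induction_on with
  | empty =>
    rw [prod_empty, prod_empty]
    exact Submodule.one_le.1 le_rfl
  | insert a s ha ih =>
    rw [prod_insert ha, prod_insert ha]
    exact Submodule.mul_mem_mul (h a (mem_insert_self _ _))
      (ih fun i hi => h i (mem_insert_of_mem hi))

/-- suppose that for each `i` the monomial factors of
`x_{m_{i-1}+1}^{α_{i,1}} ⋯ x_{m_i}^{α_{i,n_i}}` form a basis of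
`P_i = F_q[x_{m_{i-1}+1}, …, x_{m_i}]` as a module over `P_i^{G_i}`.
Then `P` is a free `P^{G_I}`-module with basis
`{ Π_s x_s^{a_s} · Π_{i,j} v_{i,j}^{b_{i,j}} : a_s < q^{τ(s)}, b_{i,j} ≤ α_{i,j} }`. -/
theorem statement14 {K : Type*} [Field K] [Fintype K] {p r : ℕ} (hp : p.Prime)
    (hr : 0 < r) (hcard : Fintype.card K = p ^ r)
    (n l : ℕ) (hl : 0 < l) (m : Fin (l + 1) → ℕ)
    (hm0 : m 0 = 0) (hmono : StrictMono m) (hlast : m (Fin.last l) = n)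
    (G : (i : Fin l) → Subgroup (GL (Fin (m i.succ - m i.castSucc)) K))
    (α : (i : Fin l) → Fin (m i.succ - m i.castSucc) → ℕ)
    (hbasis : ∀ i : Fin l,
      LinearIndependent (invariants ((G i : Set (GL (Fin (m i.succ - m i.castSucc)) K))))
        (fun c : {c : Fin (m i.succ - m i.castSucc) → ℕ // ∀ j, c j ≤ α i j} =>
          (∏ j, X j ^ c.1 j : MvPolynomial (Fin (m i.succ - m i.castSucc)) K)) ∧
      Submodule.span (invariants ((G i : Set (GL (Fin (m i.succ - m i.castSucc)) K))))
        (Set.range (fun c : {c : Fin (m i.succ - m i.castSucc) → ℕ // ∀ j, c j ≤ α i j} =>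
          (∏ j, X j ^ c.1 j : MvPolynomial (Fin (m i.succ - m i.castSucc)) K))) = ⊤) :
    LinearIndependent (invariants (GSet K n m hmono hlast G))
      (fun ab : {ab : (Fin n → ℕ) × ((i : Fin l) → Fin (m i.succ - m i.castSucc) → ℕ) //
          (∀ s : Fin n, ab.1 s < Fintype.card K ^ tauf m (s : ℕ)) ∧
          ∀ i j, ab.2 i j ≤ α i j} =>
        (∏ s : Fin n, X s ^ ab.1.1 s) *
          ∏ i : Fin l, ∏ j, vij K n m hmono hlast i j ^ ab.1.2 i j) ∧
    Submodule.span (invariants (GSet K n m hmono hlast G))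
      (Set.range (fun ab : {ab : (Fin n → ℕ) ×
            ((i : Fin l) → Fin (m i.succ - m i.castSucc) → ℕ) //
          (∀ s : Fin n, ab.1 s < Fintype.card K ^ tauf m (s : ℕ)) ∧
          ∀ i j, ab.2 i j ≤ α i j} =>
        (∏ s : Fin n, X s ^ ab.1.1 s) *
          ∏ i : Fin l, ∏ j, vij K n m hmono hlast i j ^ ab.1.2 i j)) = ⊤ := by
  classical
  set e := blockEquiv hmono hlast hm0
  set κ := {ab : (Fin n → ℕ) × ((i : Fin l) → Fin (m i.succ - m i.castSucc) → ℕ) //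
    (∀ s : Fin n, ab.1 s < Fintype.card K ^ tauf m (s : ℕ)) ∧ ∀ i j, ab.2 i j ≤ α i j}
  set w : κ → MvPolynomial (Fin n) K := fun ab => (∏ s : Fin n, X s ^ ab.1.1 s) *
    ∏ i : Fin l, ∏ j, vij K n m hmono hlast i j ^ ab.1.2 i j with hw
  have hspan : Submodule.span (invariants (GSet K n m hmono hlast G)) (Set.range w) = ⊤ := by
    set T := Submodule.span (invariants (GSet K n m hmono hlast G)) (Set.range w)
    let v : Fin n → MvPolynomial (Fin n) K := fun s =>
      vij K n m hmono hlast (e.symm s).1 (e.symm s).2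
    have hv : ∀ x, v (e x) = vij K n m hmono hlast x.1 x.2 := fun x => by
      simp only [v]
      rw [Equiv.symm_apply_apply]
    have hmd : ∀ s, (revLex n).Monic (v s) ∧
        (revLex n).degree (v s) = Finsupp.single s (Fintype.card K ^ tauf m (s : ℕ)) := by
      intro s
      obtain ⟨x, rfl⟩ := e.surjective s
      have htau : tauf m (e x : ℕ) = m x.1.castSucc := tauf_emb hmono hlast x.1 x.2
      rw [hv, htau]
      exact monic_and_degree_prod_X_add_sum _ (emb n m hmono hlast x.1 x.2) (Nat.le_add_right _ _)
    have h1 := span_prod_X_pow_mul_prod_pow_eq_top (revLex n) _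
      (fun s => pow_pos (Fintype.card_pos (α := K)) (tauf m (s : ℕ))) v
      (fun s => (hmd s).1) fun s => (hmd s).2
    have h2 : (⊤ : Submodule K (MvPolynomial (Fin n) K)) ≤ T.restrictScalars K := by
      rw [← h1, Submodule.span_le]
      rintro _ ⟨a, b, ha, rfl⟩
      rw [SetLike.mem_coe, Submodule.restrictScalars_mem]
      have hb : ∏ s, v s ^ b s ∈ ∏ i : Fin l,
          Submodule.span (invariants (GSet K n m hmono hlast G)) (Set.range
            fun c : {c : Fin (m i.succ - m i.castSucc) → ℕ // ∀ j, c j ≤ α i j} =>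
              aeval (vij K n m hmono hlast i) (∏ j, X j ^ c.1 j : MvPolynomial _ K)) := by
        rw [← e.prod_comp, Fintype.prod_sigma]
        refine Submodule.prod_mem_prod _ _ _ fun i _ => ?_
        have h3 := aeval_vij_mem_span hmono hlast hm0 i _ (hbasis i).2
          (∏ j, X j ^ b (e ⟨i, j⟩))
        simpa [hv] using h3
      rw [Submodule.prod_span] at hb
      generalize ∏ s, v s ^ b s = z at hb ⊢
      induction hb using Submodule.span_induction with
      | mem x hx =>
        obtain ⟨x, hxc, rfl⟩ := (Set.mem_fintype_prod _ _).1 hx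
        choose c hc using fun i => Set.mem_range.1 (hxc i)
        refine Submodule.subset_span ⟨⟨(a, fun i => (c i).1), ha, fun i => (c i).2⟩, ?_⟩
        simp only [hw, ← hc, map_prod, map_pow, aeval_X]
      | zero => rw [mul_zero]; exact T.zero_mem
      | add x y _ _ hx hy => rw [mul_add]; exact T.add_mem hx hy
      | smul r x _ hx => rw [mul_smul_comm]; exact T.smul_mem r hx
    exact eq_top_iff.2 h2
  refine ⟨?_, hspan⟩
  have hcard : ∀ i, Nonempty ({c : Fin (m i.succ - m i.castSucc) → ℕ // ∀ j, c j ≤ α i j} ↪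
      G i) := by
    intro i
    have : Finite {c : Fin (m i.succ - m i.castSucc) → ℕ // ∀ j, c j ≤ α i j} :=
      (Set.finite_Iic (α i)).to_subtype
    let _ := Fintype.ofFinite {c : Fin (m i.succ - m i.castSucc) → ℕ // ∀ j, c j ≤ α i j}
    let _ := Fintype.ofFinite (G i)
    refine Function.Embedding.nonempty_of_card_le ?_
    rw [← Nat.card_eq_fintype_card (α := G i)]
    exact card_le_of_linearIndependent_fixed (invariants (G i : Set _)) ((matActHom K _).comp (G i).subtype)
      (matActHom_injective.comp Subtype.val_injective) (fun x hx g hg => hx ⟨g, hg⟩) _ (hbasis i).1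
  let F := fun i => (hcard i).some
  have hE : ∀ t : Fin n, Nonempty (Fin (Fintype.card K ^ tauf m (t : ℕ)) ≃
      (Fin (tauf m (t : ℕ)) → K)) := fun t => ⟨Fintype.equivOfCardEq (by simp)⟩
  let E := fun t => (hE t).some
  have hg := fun ab : κ => exists_mem_GSet hmono hlast hm0
    (fun i => (F i ⟨ab.1.2 i, ab.2.2 i⟩ : GL (Fin (m i.succ - m i.castSucc)) K))
    (fun i => (F i ⟨ab.1.2 i, ab.2.2 i⟩).2)
    (fun s t => if hs : (s : ℕ) < tauf m (t : ℕ) then E t ⟨ab.1.1 t, ab.2.1 t⟩ ⟨s, hs⟩ else 0)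
  choose g hgG hgb hgc using hg
  have hinj : Function.Injective g := by
    intro x y hxy
    refine Subtype.ext (Prod.ext (funext fun t => ?_) (funext fun i => ?_))
    · refine congrArg Fin.val ((E t).injective (a₁ := ⟨x.1.1 t, x.2.1 t⟩)
        (a₂ := ⟨y.1.1 t, y.2.1 t⟩) (funext fun s => ?_))
      have hs : (s : ℕ) < n := s.2.trans_le ((tauf_le _).trans t.2.le)
      have h1 := hgc x ⟨s, hs⟩ t s.2
      rw [hxy, hgc y ⟨s, hs⟩ t s.2] at h1
      simpa using h1.symm
    · refine congrArg Subtype.val ((F i).injective (a₁ := ⟨x.1.2 i, x.2.2 i⟩)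
        (a₂ := ⟨y.1.2 i, y.2.2 i⟩) (Subtype.ext (Units.ext (Matrix.ext fun j k => ?_))))
      rw [← hgb x, ← hgb y, hxy]
  have : Finite κ := Finite.of_injective g hinj
  exact linearIndependent_of_span_eq_top_of_fixed (invariants (GSet K n m hmono hlast G))
    (fun ab => matActHom K n (g ab))
    (matActHom_injective.comp hinj) (fun ab x hx => hx _ (hgG ab)) w hspan
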